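/- Let n ≥ 2. There is a K-algebra homomorphism Φ : TL(B_n) → TL(B_n) determined by Φ(s_0) = −s_0 and Φ(U_i) = U_i for all 1 ≤ i ≤ n−1; Φ is an involution (Φ ∘ Φ = id), it exchanges the type B Jones–Wenzl projectors (Φ(b_{n,+}) = b_{n,−} and Φ(b_{n,−}) = b_{n,+}), and its fixed-point subalgebra equals the subalgebra TL(D_n) of TL(B_n) generated by s_0U_1s_0, U_1, …, U_{n−1}. -/

import Mathlib

noncomputable section

/-- The ground field `K = ℂ(q)`, the complex rational functions. -/
abbrev K : Type := RatFunc ℂ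

/-- The variable `q ∈ K = ℂ(q)`. -/
noncomputable def q : K := RatFunc.X

/-- `δ = q + q⁻¹ ∈ K`. -/
noncomputable def δ : K := q + q⁻¹

/-- Defining relations of the type `B` Temperley–Lieb algebra `TL(Bₙ)` (over `K`, with
`δ = q + q⁻¹`): the generator of index `0` is `s₀` and the generator of index `i`
(for `1 ≤ i ≤ n-1`) is `Uᵢ`.  The relations are `Uᵢ² = δUᵢ`, `UᵢU_{i+1}Uᵢ = Uᵢ`,
`U_{i+1}UᵢU_{i+1} = U_{i+1}`, `UᵢUⱼ = UⱼUᵢ` for `|i-j| ≥ 2`, `s₀² = 1`, `U₁s₀U₁ = 0` and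
`s₀Uᵢ = Uᵢs₀` for `i ≥ 2`. -/
inductive TLBRel (n : ℕ) : FreeAlgebra K (Fin n) → FreeAlgebra K (Fin n) → Prop
  | Usq (i : Fin n) (hi : 1 ≤ (i : ℕ)) :
      TLBRel n (FreeAlgebra.ι K i * FreeAlgebra.ι K i) (δ • FreeAlgebra.ι K i)
  | braid₁ (i j : Fin n) (hi : 1 ≤ (i : ℕ)) (hj : (j : ℕ) = (i : ℕ) + 1) :
      TLBRel n (FreeAlgebra.ι K i * FreeAlgebra.ι K j * FreeAlgebra.ι K i) (FreeAlgebra.ι K i)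
  | braid₂ (i j : Fin n) (hi : 1 ≤ (i : ℕ)) (hj : (j : ℕ) = (i : ℕ) + 1) :
      TLBRel n (FreeAlgebra.ι K j * FreeAlgebra.ι K i * FreeAlgebra.ι K j) (FreeAlgebra.ι K j)
  | Ucomm (i j : Fin n) (hi : 1 ≤ (i : ℕ)) (h : (i : ℕ) + 2 ≤ (j : ℕ)) :
      TLBRel n (FreeAlgebra.ι K i * FreeAlgebra.ι K j) (FreeAlgebra.ι K j * FreeAlgebra.ι K i)
  | s0sq (i : Fin n) (hi : (i : ℕ) = 0) : TLBRel n (FreeAlgebra.ι K i * FreeAlgebra.ι K i) 1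
  | UsU (i j : Fin n) (hi : (i : ℕ) = 0) (hj : (j : ℕ) = 1) :
      TLBRel n (FreeAlgebra.ι K j * FreeAlgebra.ι K i * FreeAlgebra.ι K j) 0
  | s0comm (i j : Fin n) (hi : (i : ℕ) = 0) (h : 2 ≤ (j : ℕ)) :
      TLBRel n (FreeAlgebra.ι K i * FreeAlgebra.ι K j) (FreeAlgebra.ι K j * FreeAlgebra.ι K i)

/-- The type `B` Temperley–Lieb algebra `TL(Bₙ)` over `K = ℂ(q)` with `δ = q + q⁻¹`. -/
abbrev TLB (n : ℕ) := RingQuot (TLBRel n)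

/-- The generator of `TL(Bₙ)` with index `i`: `g n 0 = s₀`, and `g n i = Uᵢ` for
`1 ≤ i ≤ n-1` (indices out of range are sent to `0`). -/
noncomputable def g (n : ℕ) (i : ℕ) : TLB n :=
  if h : i < n then RingQuot.mkAlgHom K (TLBRel n) (FreeAlgebra.ι K ⟨i, h⟩) else 0

/-- `IsJW n ε b` says that `b` is a type `B` Jones–Wenzl projector of sign `ε` in `TL(Bₙ)`:
`b` is a nonzero idempotent with `s₀·b = ε·b = b·s₀` and `Uᵢ·b = 0 = b·Uᵢ` for all
`1 ≤ i ≤ n-1`.  For `ε = 1` this characterizes `b_{n,+}` and for `ε = -1` it characterizes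
`b_{n,-}`. -/
def IsJW (n : ℕ) (ε : K) (b : TLB n) : Prop :=
  b ≠ 0 ∧ b * b = b ∧ g n 0 * b = ε • b ∧ b * g n 0 = ε • b ∧
    ∀ i : ℕ, 1 ≤ i → i ≤ n - 1 → g n i * b = 0 ∧ b * g n i = 0

theorem g_of_lt {n i : ℕ} (h : i < n) :
    g n i = RingQuot.mkAlgHom K (TLBRel n) (FreeAlgebra.ι K ⟨i, h⟩) := dif_pos h

theorem g_zero_mul_self {n : ℕ} (hn : 0 < n) : g n 0 * g n 0 = 1 := by
  rw [g_of_lt hn, ← map_mul, RingQuot.mkAlgHom_rel K (TLBRel.s0sq ⟨0, hn⟩ rfl), map_one]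

theorem g_zero_comm {n i : ℕ} (hi : 2 ≤ i) (h : i < n) : g n 0 * g n i = g n i * g n 0 := by
  have hn : 0 < n := by lia
  rw [g_of_lt h, g_of_lt hn, ← map_mul, ← map_mul,
    RingQuot.mkAlgHom_rel K (TLBRel.s0comm ⟨0, hn⟩ ⟨i, h⟩ rfl hi)]

/-- The elements `s₀, U₁, …, U_{n-1}` generate `TL(Bₙ)`. -/
theorem adjoin_g_eq_top (n : ℕ) : Algebra.adjoin K {y : TLB n | ∃ i < n, y = g n i} = ⊤ := by
  rw [eq_top_iff]
  intro x _
  obtain ⟨w, rfl⟩ := RingQuot.mkAlgHom_surjective K (TLBRel n) x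
  induction w using FreeAlgebra.induction with
  | grade0 r =>
    rw [AlgHom.commutes]
    exact Subalgebra.algebraMap_mem _ r
  | grade1 i => exact Algebra.subset_adjoin ⟨i, i.2, (g_of_lt i.2).symm⟩
  | mul a b ha hb => rw [map_mul]; exact mul_mem (ha trivial) (hb trivial)
  | add a b ha hb => rw [map_add]; exact add_mem (ha trivial) (hb trivial)

/-- Two algebra homomorphisms out of `TL(Bₙ)` that agree on the generators are equal. -/
theorem TLB.algHom_ext {n : ℕ} {A : Type*} [Semiring A] [Algebra K A] {f h : TLB n →ₐ[K] A}
    (H : ∀ i < n, f (g n i) = h (g n i)) : f = h :=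
  AlgHom.ext_of_adjoin_eq_top (adjoin_g_eq_top n) (by rintro _ ⟨i, hi, rfl⟩; exact H i hi)

/-- Negation in `TL(Bₙ)` as a scalar multiplication. The negation of `RingQuot` and the ring
structure of `TL(Bₙ)` match only after unfolding, so the simp lemmas on negation do not apply. -/
theorem TLB.neg_eq_smul {n : ℕ} (x : TLB n) : -x = (-1 : K) • x := (neg_one_smul K x).symm

/-- The images of the generators under `signFlip`. -/
def signedGen (n : ℕ) (i : Fin n) : TLB n := if (i : ℕ) = 0 then - g n 0 else g n i

theorem signedGen_zero {n : ℕ} {i : Fin n} (hi : (i : ℕ) = 0) :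
    signedGen n i = - RingQuot.mkAlgHom K (TLBRel n) (FreeAlgebra.ι K i) := by
  have h : g n i = RingQuot.mkAlgHom K (TLBRel n) (FreeAlgebra.ι K i) := g_of_lt i.2
  rw [signedGen, if_pos hi, ← h, hi]

theorem signedGen_pos {n : ℕ} {i : Fin n} (hi : 1 ≤ (i : ℕ)) :
    signedGen n i = RingQuot.mkAlgHom K (TLBRel n) (FreeAlgebra.ι K i) := by
  rw [signedGen, if_neg (by lia), g_of_lt i.2]

/-- The endomorphism of `TL(Bₙ)` with `s₀ ↦ -s₀` and `Uᵢ ↦ Uᵢ`. -/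
def signFlip (n : ℕ) : TLB n →ₐ[K] TLB n :=
  RingQuot.liftAlgHom K ⟨FreeAlgebra.lift K (signedGen n), by
    intro x y hxy
    have key := RingQuot.mkAlgHom_rel K hxy
    cases hxy with
    | Usq i hi => simpa [signedGen_pos hi] using key
    | braid₁ i j hi hj =>
      simpa [signedGen_pos hi, signedGen_pos (show 1 ≤ (j : ℕ) by lia)] using key
    | braid₂ i j hi hj =>
      simpa [signedGen_pos hi, signedGen_pos (show 1 ≤ (j : ℕ) by lia)] using key
    | Ucomm i j hi h =>
      simpa [signedGen_pos hi, signedGen_pos (show 1 ≤ (j : ℕ) by lia)] using key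
    | s0sq i hi => simpa [smul_smul, TLB.neg_eq_smul, signedGen_zero hi] using key
    | UsU i j hi hj => simpa [TLB.neg_eq_smul, signedGen_zero hi, signedGen_pos hj.ge] using key
    | s0comm i j hi h =>
      simpa [TLB.neg_eq_smul, signedGen_zero hi, signedGen_pos (show 1 ≤ (j : ℕ) by lia)] using key⟩

theorem signFlip_g {n i : ℕ} (h : i < n) : signFlip n (g n i) = signedGen n ⟨i, h⟩ := by
  rw [g_of_lt h, signFlip, RingQuot.liftAlgHom_mkAlgHom_apply, FreeAlgebra.lift_ι_apply]

theorem signFlip_g_zero {n : ℕ} (hn : 0 < n) : signFlip n (g n 0) = - g n 0 := by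
  rw [signFlip_g hn, signedGen, if_pos rfl]

theorem signFlip_g_pos {n i : ℕ} (hi : 1 ≤ i) (h : i < n) : signFlip n (g n i) = g n i := by
  rw [signFlip_g h, signedGen, if_neg (show i ≠ 0 by lia)]

theorem signFlip_comp_self (n : ℕ) : (signFlip n).comp (signFlip n) = AlgHom.id K (TLB n) := by
  refine TLB.algHom_ext fun i hi => ?_
  rcases Nat.eq_zero_or_pos i with rfl | hi'
  · simp [signFlip_g_zero hi]
  · simp [signFlip_g_pos hi' hi]

theorem signFlip_signFlip {n : ℕ} (x : TLB n) : signFlip n (signFlip n x) = x :=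
  DFunLike.congr_fun (signFlip_comp_self n) x

/-- Every element of `TL(Bₙ)` acts on the Jones–Wenzl projectors of sign `ε` by one scalar. -/
theorem exists_smul_of_isJW {n : ℕ} (ε : K) (x : TLB n) :
    ∃ c : K, ∀ b, IsJW n ε b → x * b = c • b ∧ b * x = c • b := by
  have hx : x ∈ Algebra.adjoin K {y : TLB n | ∃ i < n, y = g n i} := by
    rw [adjoin_g_eq_top]; trivial
  induction hx using Algebra.adjoin_induction with
  | mem y hy =>
    obtain ⟨i, hi, rfl⟩ := hy
    rcases Nat.eq_zero_or_pos i with rfl | hi'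
    · exact ⟨ε, fun b hb => ⟨hb.2.2.1, hb.2.2.2.1⟩⟩
    · exact ⟨0, fun b hb => by simpa using hb.2.2.2.2 i hi' (by lia)⟩
  | algebraMap r =>
    exact ⟨r, fun b _ => ⟨(Algebra.smul_def r b).symm,
      by rw [Algebra.smul_def, Algebra.commutes]⟩⟩
  | add y z _ _ hy hz =>
    obtain ⟨c, hc⟩ := hy
    obtain ⟨d, hd⟩ := hz
    exact ⟨c + d, fun b hb => by
      rw [add_mul, mul_add, (hc b hb).1, (hc b hb).2, (hd b hb).1, (hd b hb).2, add_smul]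
      exact ⟨rfl, rfl⟩⟩
  | mul y z _ _ hy hz =>
    obtain ⟨c, hc⟩ := hy
    obtain ⟨d, hd⟩ := hz
    refine ⟨c * d, fun b hb => ⟨?_, ?_⟩⟩
    · rw [mul_assoc, (hd b hb).1, mul_smul_comm, (hc b hb).1, smul_smul, mul_comm]
    · rw [← mul_assoc, (hc b hb).2, smul_mul_assoc, (hd b hb).2, smul_smul]

theorem IsJW.eq {n : ℕ} {ε : K} {b b' : TLB n} (hb : IsJW n ε b) (hb' : IsJW n ε b') :
    b = b' := by
  obtain ⟨c, hc⟩ := exists_smul_of_isJW ε b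
  obtain ⟨d, hd⟩ := exists_smul_of_isJW ε b'
  have hc1 : c = 1 := by
    have h : c • b = (1 : K) • b := by rw [← (hc b hb).1, hb.2.1, one_smul]
    exact smul_left_injective K hb.1 h
  have hd1 : d = 1 := by
    have h : d • b' = (1 : K) • b' := by rw [← (hd b' hb').1, hb'.2.1, one_smul]
    exact smul_left_injective K hb'.1 h
  rw [← one_smul K b, ← hd1, ← (hd b hb).2, (hc b' hb').1, hc1, one_smul]

theorem IsJW.map_signFlip {n : ℕ} (hn : 0 < n) {ε : K} {b : TLB n} (hb : IsJW n ε b) :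
    IsJW n (-ε) (signFlip n b) := by
  obtain ⟨h0, h1, h2, h3, h4⟩ := hb
  have h0' : g n 0 = (-1 : K) • signFlip n (g n 0) := by
    rw [signFlip_g_zero hn, TLB.neg_eq_smul, smul_smul, neg_one_mul, neg_neg, one_smul]
  refine ⟨fun h => h0 ?_, by rw [← map_mul, h1], ?_, ?_, fun i hi hi' => ⟨?_, ?_⟩⟩
  · rw [← signFlip_signFlip b, h, map_zero]
  · rw [h0', smul_mul_assoc, ← map_mul, h2, map_smul, smul_smul, neg_one_mul]
  · rw [h0', mul_smul_comm, ← map_mul, h3, map_smul, smul_smul, neg_one_mul]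
  · rw [← signFlip_g_pos hi (show i < n by lia), ← map_mul, (h4 i hi hi').1, map_zero]
  · rw [← signFlip_g_pos hi (show i < n by lia), ← map_mul, (h4 i hi hi').2, map_zero]

/-- The subalgebra `TL(Dₙ)` of `TL(Bₙ)`. -/
def TLD (n : ℕ) : Subalgebra K (TLB n) :=
  Algebra.adjoin K
    ({g n 0 * g n 1 * g n 0} ∪ {y : TLB n | ∃ i : ℕ, 1 ≤ i ∧ i ≤ n - 1 ∧ y = g n i})

theorem g_mem_TLD {n i : ℕ} (hi : 1 ≤ i) (h : i < n) : g n i ∈ TLD n :=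
  Algebra.subset_adjoin (Or.inr ⟨i, hi, by lia, rfl⟩)

theorem signFlip_of_mem_TLD {n : ℕ} (hn : 2 ≤ n) {x : TLB n} (hx : x ∈ TLD n) :
    signFlip n x = x := by
  suffices TLD n ≤ AlgHom.equalizer (signFlip n) (AlgHom.id K (TLB n)) from this hx
  refine Algebra.adjoin_le ?_
  rintro _ (rfl | ⟨i, hi, hi', rfl⟩)
  · simp [smul_smul, TLB.neg_eq_smul, signFlip_g_zero (show 0 < n by lia),
      signFlip_g_pos le_rfl (show 1 < n by lia)]
  · simp [signFlip_g_pos hi (show i < n by lia)]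

/-- `TL(Dₙ)` is stable under conjugation by `s₀`. -/
theorem conj_mem_TLD {n : ℕ} (hn : 2 ≤ n) {x : TLB n} (hx : x ∈ TLD n) :
    g n 0 * x * g n 0 ∈ TLD n := by
  have hs : g n 0 * g n 0 = 1 := g_zero_mul_self (by lia)
  have hs' (y : TLB n) : g n 0 * (g n 0 * y) = y := by rw [← mul_assoc, hs, one_mul]
  induction hx using Algebra.adjoin_induction with
  | mem y hy =>
    rcases hy with rfl | ⟨i, hi, hi', rfl⟩
    · simpa only [mul_assoc, hs', hs, mul_one] using g_mem_TLD le_rfl (show 1 < n by lia)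
    · rcases hi.eq_or_lt with rfl | hi2
      · exact Algebra.subset_adjoin (Or.inl rfl)
      · rw [g_zero_comm hi2 (by lia), mul_assoc, hs, mul_one]
        exact g_mem_TLD hi (by lia)
  | algebraMap r =>
    rw [← Algebra.commutes, mul_assoc, hs, mul_one]
    exact Subalgebra.algebraMap_mem _ r
  | add y z _ _ hy hz => rw [mul_add, add_mul]; exact add_mem hy hz
  | mul y z _ _ hy hz =>
    have h : g n 0 * (y * z) * g n 0 = (g n 0 * y * g n 0) * (g n 0 * z * g n 0) := by
      simp only [mul_assoc, hs']
    rw [h]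
    exact mul_mem hy hz

/-- The decomposition `TL(Bₙ) = TL(Dₙ) + s₀ TL(Dₙ)`. -/
theorem exists_add_g_zero_mul {n : ℕ} (hn : 2 ≤ n) (x : TLB n) :
    ∃ a ∈ TLD n, ∃ b ∈ TLD n, x = a + g n 0 * b := by
  have hs : g n 0 * g n 0 = 1 := g_zero_mul_self (by lia)
  have hs' (y : TLB n) : g n 0 * (g n 0 * y) = y := by rw [← mul_assoc, hs, one_mul]
  have hx : x ∈ Algebra.adjoin K {y : TLB n | ∃ i < n, y = g n i} := by
    rw [adjoin_g_eq_top]; trivial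
  induction hx using Algebra.adjoin_induction with
  | mem y hy =>
    obtain ⟨i, hi, rfl⟩ := hy
    rcases Nat.eq_zero_or_pos i with rfl | hi'
    · exact ⟨0, zero_mem _, 1, one_mem _, by simp⟩
    · exact ⟨g n i, g_mem_TLD hi' hi, 0, zero_mem _, by simp⟩
  | algebraMap r => exact ⟨_, Subalgebra.algebraMap_mem _ r, 0, zero_mem _, by simp⟩
  | add y z _ _ hy hz =>
    obtain ⟨a, ha, b, hb, rfl⟩ := hy
    obtain ⟨c, hc, d, hd, rfl⟩ := hz
    exact ⟨a + c, add_mem ha hc, b + d, add_mem hb hd, by rw [mul_add]; abel⟩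
  | mul y z _ _ hy hz =>
    obtain ⟨a, ha, b, hb, rfl⟩ := hy
    obtain ⟨c, hc, d, hd, rfl⟩ := hz
    refine ⟨a * c + (g n 0 * b * g n 0) * d,
      add_mem (mul_mem ha hc) (mul_mem (conj_mem_TLD hn hb) hd),
      b * c + (g n 0 * a * g n 0) * d,
      add_mem (mul_mem hb hc) (mul_mem (conj_mem_TLD hn ha) hd), ?_⟩
    simp only [mul_add, add_mul, mul_assoc, hs']
    abel

theorem signFlip_eq_self_iff {n : ℕ} (hn : 2 ≤ n) (x : TLB n) :
    signFlip n x = x ↔ x ∈ TLD n := by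
  refine ⟨fun h => ?_, signFlip_of_mem_TLD hn⟩
  obtain ⟨a, ha, b, hb, rfl⟩ := exists_add_g_zero_mul hn x
  rw [map_add, map_mul, signFlip_g_zero (by lia), signFlip_of_mem_TLD hn ha,
    signFlip_of_mem_TLD hn hb, add_right_inj, TLB.neg_eq_smul,
    smul_mul_assoc] at h
  have h2 : (2 : K) • (g n 0 * b) = 0 := by
    rw [two_smul]
    nth_rewrite 1 [← h]
    rw [← TLB.neg_eq_smul]
    exact neg_add_cancel _
  rw [(smul_eq_zero.mp h2).resolve_left two_ne_zero, add_zero]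
  exact ha

/-- For `n ≥ 2` there is a `K`-algebra homomorphism
`Φ : TL(Bₙ) → TL(Bₙ)` with `Φ(s₀) = -s₀` and `Φ(Uᵢ) = Uᵢ` for `1 ≤ i ≤ n-1`; it is an
involution, it exchanges the two type `B` Jones–Wenzl projectors, and its fixed points are
exactly the subalgebra `TL(Dₙ)` generated by `s₀U₁s₀, U₁, …, U_{n-1}`. -/
theorem stmt_12 (n : ℕ) (hn : 2 ≤ n) :
    ∃ Φ : TLB n →ₐ[K] TLB n,
      Φ (g n 0) = - g n 0 ∧
      (∀ i : ℕ, 1 ≤ i → i ≤ n - 1 → Φ (g n i) = g n i) ∧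
      Φ.comp Φ = AlgHom.id K (TLB n) ∧
      (∀ bp bm : TLB n, IsJW n 1 bp → IsJW n (-1) bm → Φ bp = bm ∧ Φ bm = bp) ∧
      (∀ x : TLB n, Φ x = x ↔
        x ∈ Algebra.adjoin K
          ({g n 0 * g n 1 * g n 0} ∪ {y : TLB n | ∃ i : ℕ, 1 ≤ i ∧ i ≤ n - 1 ∧ y = g n i})) := by
  refine ⟨signFlip n, signFlip_g_zero (by lia), fun i hi hi' => signFlip_g_pos hi (by lia),
    signFlip_comp_self n, fun bp bm hp hm => ⟨(hp.map_signFlip (by lia)).eq hm, ?_⟩,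
    signFlip_eq_self_iff hn⟩
  have h := hm.map_signFlip (by lia)
  rw [neg_neg] at h
  exact h.eq hp
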